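/- arXiv:2406.12864 — 2 statements merged into one kernel-verified Lean document; each statement's English description precedes it below -/
import Mathlib

section
/- Let k be a natural number, let R be a commutative ring with distinguished units t, s₁, …, s_k, and let X be an R-module. Define operations on X by x ⊲⁰ y := t•x + (1−t)•y, x ⊳⁰ y := x, and x ∗ⁱ y := sᵢ•x for 1 ≤ i ≤ k. Then X with these operations is a k-flat biquandle, i.e.: (1) (X, ⊲⁰, ⊳⁰) is a biquandle; (2) for each 1 ≤ i ≤ k, the map x ↦ x ∗ⁱ y is a bijection of X for every y, the map (x,y) ↦ (x ∗ⁱ y, y ∗ⁱ x) is a bijection of X × X, and (x ∗ⁱ y) ∗ⁱ (z ∗ⁱ y) = (x ∗ⁱ z) ∗ⁱ (y ∗ⁱ z) for all x, y, z; (3) for all 0 ≤ i < j ≤ k and all x, y, z (writing ⊳ⁱ = ⊲ⁱ = ∗ⁱ when i > 0): (x ⊳ⁱ y) ∗ʲ (z ∗ʲ y) = (x ∗ʲ z) ⊳ⁱ (y ∗ʲ z), (x ⊲ⁱ y) ∗ʲ (z ∗ʲ y) = (x ∗ʲ z) ⊲ⁱ (y ∗ʲ z), and (x ∗ʲ y)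 ∗ʲ (z ⊳ⁱ y) = (x ∗ʲ z) ∗ʲ (y ⊲ⁱ z). This structure is called the k-flat Alexander quandle. -/
/-- A biquandle structure given by two binary operations: `und` (the "under"
operation `⊲`) and `ovr` (the "over" operation `⊳`). -/
def IsBiquandle {X : Type*} (und ovr : X → X → X) : Prop :=
  (∀ x : X, ovr x x = und x x) ∧
  (∀ y : X, Function.Bijective fun x => ovr x y) ∧
  (∀ y : X, Function.Bijective fun x => und x y) ∧
  (Function.Bijective fun p : X × X => (ovr p.1 p.2, und p.2 p.1)) ∧
  (∀ x y z : X, ovr (ovr x y) (ovr z y) = ovr (ovr x z) (und y z)) ∧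
  (∀ x y z : X, ovr (und x y) (und z y) = und (ovr x z) (ovr y z)) ∧
  (∀ x y z : X, und (und x y) (und z y) = und (und x z) (ovr y z))

/-- A flat biquandle operation on a set `X`. -/
def IsFlatBiquandleOp {X : Type*} (op : X → X → X) : Prop :=
  (∀ y : X, Function.Bijective fun x => op x y) ∧
  (Function.Bijective fun p : X × X => (op p.1 p.2, op p.2 p.1)) ∧
  (∀ x y z : X, op (op x y) (op z y) = op (op x z) (op y z))

/-- A `k`-flat biquandle: a biquandle `(X, ⊲⁰, ⊳⁰)` together with flat
operations `∗¹, …, ∗ᵏ` (indexed by `Fin k`) satisfying the mixed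
compatibility relations for all `0 ≤ i < j ≤ k` (where `⊳ⁱ = ⊲ⁱ = ∗ⁱ` for
`i > 0`). -/
def IsKFlatBiquandle {X : Type*} (k : ℕ) (und ovr : X → X → X)
    (ops : Fin k → X → X → X) : Prop :=
  -- (1) (X, ⊲⁰, ⊳⁰) is a biquandle
  IsBiquandle und ovr ∧
  -- (2) each ∗ⁱ is a flat biquandle operation
  (∀ i : Fin k, IsFlatBiquandleOp (ops i)) ∧
  -- (3) mixed relations for i = 0 < j:
  (∀ j : Fin k, ∀ x y z : X,
    ops j (ovr x y) (ops j z y) = ovr (ops j x z) (ops j y z)) ∧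
  (∀ j : Fin k, ∀ x y z : X,
    ops j (und x y) (ops j z y) = und (ops j x z) (ops j y z)) ∧
  (∀ j : Fin k, ∀ x y z : X,
    ops j (ops j x y) (ovr z y) = ops j (ops j x z) (und y z)) ∧
  -- (3) mixed relations for 0 < i < j:
  (∀ i j : Fin k, i < j → ∀ x y z : X,
    ops j (ops i x y) (ops j z y) = ops i (ops j x z) (ops j y z)) ∧
  (∀ i j : Fin k, i < j → ∀ x y z : X,
    ops j (ops j x y) (ops i z y) = ops j (ops j x z) (ops i y z))

/-- The `k`-flat Alexander quandle: on a module `X` over a commutative ring `R`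
with units `t, s₁, …, s_k`, the operations `x ⊲⁰ y = t•x + (1-t)•y`,
`x ⊳⁰ y = x`, `x ∗ⁱ y = sᵢ•x` form a `k`-flat biquandle. -/
theorem alexander_isKFlatBiquandle (k : ℕ) {R : Type*} [CommRing R]
    (t : Rˣ) (s : Fin k → Rˣ)
    {X : Type*} [AddCommGroup X] [Module R X] :
    IsKFlatBiquandle k
      (fun x y : X => (t : R) • x + (1 - (t : R)) • y)
      (fun x _ : X => x)
      (fun i (x _ : X) => (s i : R) • x) := by
  have smul_bij (u : Rˣ) : Function.Bijective fun x : X => (u : R) • x :=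
    MulAction.bijective u
  have und_bij (y : X) :
      Function.Bijective fun x : X => (t : R) • x + (1 - (t : R)) • y :=
    (Equiv.addRight ((1 - (t : R)) • y)).bijective.comp (smul_bij t)
  refine ⟨⟨fun x => by module, fun _ => Function.bijective_id, und_bij, ⟨?_, ?_⟩,
    fun _ _ _ => rfl, fun _ _ _ => rfl, fun x y z => by module⟩,
    fun i => ⟨fun _ => smul_bij (s i), (smul_bij (s i)).prodMap (smul_bij (s i)),
      fun _ _ _ => rfl⟩,
    fun _ _ _ _ => rfl, fun j x y z => by module, fun _ _ _ _ => rfl,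
    fun i j _ x y z => smul_comm _ _ _, fun _ _ _ _ _ _ => rfl⟩
  · rintro ⟨a, b⟩ ⟨c, d⟩ h
    obtain ⟨rfl, h⟩ := Prod.mk.inj h
    exact Prod.ext rfl ((und_bij a).injective h)
  · rintro ⟨a, b⟩
    obtain ⟨y, hy⟩ := (und_bij a).surjective b
    exact ⟨(a, y), Prod.ext rfl hy⟩
end

section
/- Let k be a natural number, let (X, ⊲, ⊳) be a biquandle, let f₁, …, f_k : X → X be maps, and define operations on X by x ∗ⁱ y := fᵢ(x) for 1 ≤ i ≤ k (so x ∗ⁱ y does not depend on y). Then (X, ⊳, ⊲, ∗¹, …, ∗ᵏ) is a k-flat biquandle if and only if each fᵢ is a bijection of X which is an automorphism of the biquandle structure, i.e. fᵢ(x ⊲ y) = fᵢ(x) ⊲ fᵢ(y) and fᵢ(x ⊳ y) = fᵢ(x) ⊳ fᵢ(y) for all x, y ∈ X, and the maps pairwise commute: fᵢ ∘ fⱼ = fⱼ ∘ fᵢ for all 1 ≤ i, j ≤ k. -/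
/-- Let `(X, ⊲, ⊳)` be a biquandle and `f₁, …, f_k : X → X` maps; set
`x ∗ⁱ y := fᵢ(x)`. Then these operations form a `k`-flat biquandle iff each
`fᵢ` is a bijective automorphism of the biquandle structure and the `fᵢ`
pairwise commute. -/
theorem isKFlatBiquandle_of_maps_iff {X : Type*} (k : ℕ)
    (und ovr : X → X → X) (hbq : IsBiquandle und ovr)
    (f : Fin k → X → X) :
    IsKFlatBiquandle k und ovr (fun i (x _ : X) => f i x) ↔
      ((∀ i : Fin k, Function.Bijective (f i)) ∧
       (∀ i : Fin k, ∀ x y : X, f i (und x y) = und (f i x) (f i y)) ∧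
       (∀ i : Fin k, ∀ x y : X, f i (ovr x y) = ovr (f i x) (f i y)) ∧
       (∀ i j : Fin k, f i ∘ f j = f j ∘ f i)) := by
  constructor
  · rintro ⟨-, hflat, hovr, hund, -, hcomm, -⟩
    refine ⟨fun i => ⟨fun x y h => ((hflat i).1 x).1 h, fun y => ((hflat i).1 y).2 y⟩,
      fun i x y => hund i x y x, fun i x y => hovr i x y x, fun i j => ?_⟩
    funext x
    rcases lt_trichotomy i j with h | rfl | h
    · exact (hcomm i j h x x x).symm
    · rfl
    · exact hcomm j i h x x x
  · rintro ⟨hbij, hund, hovr, hcomm⟩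
    exact ⟨hbq, fun i => ⟨fun _ => hbij i, (hbij i).prodMap (hbij i), fun _ _ _ => rfl⟩,
      fun j x y _ => hovr j x y, fun j x y _ => hund j x y, fun _ _ _ _ => rfl,
      fun i j _ x _ _ => congrFun (hcomm j i) x, fun _ _ _ _ _ _ => rfl⟩
end
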